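/- arXiv:2512.24082 — 2 statements merged into one kernel-verified Lean document; each statement's English description precedes it below -/
import Mathlib

section
/- Let g be a positive definite symmetric bilinear form and b an alternating bilinear form on V. For X ∈ V set X⁺ = (X, g♭(X) + b♭(X)) and X⁻ = (X, −g♭(X) + b♭(X)) in E = V × V*. Then for all X, Y ∈ V: ⟨X⁺, Y⁺⟩ = g(X,Y), ⟨X⁻, Y⁻⟩ = −g(X,Y), and ⟨X⁺, Y⁻⟩ = 0. Consequently V⁺ = {X⁺ : X ∈ V} is a subspace of dimension dim V on which the natural pairing is positive definite, V⁻ = {X⁻ : X ∈ V} is a subspace of dimension dim V on which the natural pairing is negative definite, E = V⁺ ⊕ V⁻, and V⁻ is the orthogonal complement of V⁺ with respect to the natural pairing. (The structure of the generalized metric determined by the pair (g,b): V⁺ is the graph of g+b and V⁻ the graph of −g+b.) -/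
/-- The natural pairing on `E = V × V*`: `⟨(X,ξ),(Y,η)⟩ = (1/2)(η(X) + ξ(Y))`. -/
noncomputable def natPair {V : Type*} [AddCommGroup V] [Module ℝ V]
    (u v : V × Module.Dual ℝ V) : ℝ :=
  (v.2 u.1 + u.2 v.1) / 2

theorem LinearMap.finrank_graph {V W : Type*} [AddCommGroup V] [Module ℝ V] [AddCommGroup W]
    [Module ℝ W] (f : V →ₗ[ℝ] W) : Module.finrank ℝ f.graph = Module.finrank ℝ V := by
  rw [LinearMap.graph_eq_range_prod]
  exact LinearMap.finrank_range_of_inj fun x y h => congrArg Prod.fst h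

theorem LinearMap.surjective_of_posDef {V : Type*} [AddCommGroup V] [Module ℝ V]
    [FiniteDimensional ℝ V] (g : V →ₗ[ℝ] V →ₗ[ℝ] ℝ) (hg : ∀ X : V, X ≠ 0 → 0 < g X X)
    (ξ : Module.Dual ℝ V) : ∃ U, g U = ξ := by
  have hinj : Function.Injective g := by
    refine (injective_iff_map_eq_zero g).2 fun X hX => ?_
    by_contra h
    simpa [hX] using hg X h
  exact (LinearMap.injective_iff_surjective_of_finrank_eq_finrank
    Subspace.dual_finrank_eq.symm).1 hinj ξ

/-- The structure of the generalized metric determined by a pair `(g,b)`: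
`V⁺` is the graph of `g+b`, `V⁻` the graph of `−g+b`; `⟨X⁺,Y⁺⟩ = g(X,Y)`,
`⟨X⁻,Y⁻⟩ = −g(X,Y)`, `⟨X⁺,Y⁻⟩ = 0`; both graphs have dimension `dim V`, the
pairing is positive (resp. negative) definite on `V⁺` (resp. `V⁻`),
`E = V⁺ ⊕ V⁻`, and `V⁻` is the orthogonal complement of `V⁺`. -/
theorem stmt_6 (V : Type*) [AddCommGroup V] [Module ℝ V] [FiniteDimensional ℝ V]
    (g b : V →ₗ[ℝ] V →ₗ[ℝ] ℝ)
    (hgsymm : ∀ X Y : V, g X Y = g Y X)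
    (hgpos : ∀ X : V, X ≠ 0 → 0 < g X X)
    (halt : ∀ X : V, b X X = 0) :
    (∀ X Y : V, natPair (X, g X + b X) (Y, g Y + b Y) = g X Y)
    ∧ (∀ X Y : V, natPair (X, -g X + b X) (Y, -g Y + b Y) = -g X Y)
    ∧ (∀ X Y : V, natPair (X, g X + b X) (Y, -g Y + b Y) = 0)
    ∧ Module.finrank ℝ (LinearMap.graph (g + b)) = Module.finrank ℝ V
    ∧ Module.finrank ℝ (LinearMap.graph (-g + b)) = Module.finrank ℝ V
    ∧ (∀ p ∈ LinearMap.graph (g + b), p ≠ 0 → 0 < natPair p p)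
    ∧ (∀ p ∈ LinearMap.graph (-g + b), p ≠ 0 → natPair p p < 0)
    ∧ IsCompl (LinearMap.graph (g + b)) (LinearMap.graph (-g + b))
    ∧ (∀ p : V × Module.Dual ℝ V,
        p ∈ LinearMap.graph (-g + b) ↔ ∀ q ∈ LinearMap.graph (g + b), natPair p q = 0) := by
  have hskew : ∀ X Y : V, b X Y = -b Y X := fun X Y => by
    have h := halt (X + Y)
    simp only [map_add, LinearMap.add_apply, halt] at h
    linarith
  have hpp : ∀ X Y : V, natPair (X, g X + b X) (Y, g Y + b Y) = g X Y := fun X Y => by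
    simp only [natPair, LinearMap.add_apply]
    linarith [hgsymm X Y, hskew X Y]
  have hmm : ∀ X Y : V, natPair (X, -g X + b X) (Y, -g Y + b Y) = -g X Y := fun X Y => by
    simp only [natPair, LinearMap.add_apply, LinearMap.neg_apply]
    linarith [hgsymm X Y, hskew X Y]
  have hpm : ∀ X Y : V, natPair (X, g X + b X) (Y, -g Y + b Y) = 0 := fun X Y => by
    simp only [natPair, LinearMap.add_apply, LinearMap.neg_apply]
    linarith [hgsymm X Y, hskew X Y]
  refine ⟨hpp, hmm, hpm, LinearMap.finrank_graph _, LinearMap.finrank_graph _, ?_, ?_, ?_, ?_⟩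
  · rintro ⟨X, ξ⟩ hp h0
    obtain rfl : ξ = g X + b X := hp
    rw [hpp]
    refine hgpos X ?_
    rintro rfl
    simp at h0
  · rintro ⟨X, ξ⟩ hp h0
    obtain rfl : ξ = -g X + b X := hp
    rw [hmm]
    refine neg_neg_of_pos (hgpos X ?_)
    rintro rfl
    simp at h0
  · constructor
    · rw [Submodule.disjoint_def]
      rintro ⟨X, ξ⟩ hp hm
      obtain rfl : ξ = g X + b X := hp
      have h : g X + b X = -g X + b X := hm
      have hX : X = 0 := by
        by_contra h0
        have h' := LinearMap.congr_fun h X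
        simp only [LinearMap.add_apply, LinearMap.neg_apply] at h'
        linarith [hgpos X h0]
      simp [hX]
    · rw [codisjoint_iff, eq_top_iff]
      rintro ⟨X, ξ⟩ -
      obtain ⟨U, hU⟩ := LinearMap.surjective_of_posDef g hgpos (ξ - b X)
      obtain rfl : ξ = g U + b X := by rw [hU]; abel
      refine Submodule.mem_sup.2
        ⟨((1 / 2 : ℝ) • (X + U), (g + b) ((1 / 2 : ℝ) • (X + U))), rfl,
          ((1 / 2 : ℝ) • (X - U), (-g + b) ((1 / 2 : ℝ) • (X - U))), rfl, ?_⟩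
      ext1
      · simp only [Prod.mk_add_mk]
        module
      · simp only [Prod.mk_add_mk, LinearMap.add_apply, LinearMap.neg_apply, map_smul, map_add,
          map_sub]
        module
  · rintro ⟨X, ξ⟩
    constructor
    · rintro hp ⟨Y, η⟩ hq
      obtain rfl : ξ = -g X + b X := hp
      obtain rfl : η = g Y + b Y := hq
      have h := hpm Y X
      simp only [natPair] at h ⊢
      linarith
    · intro h
      change ξ = -g X + b X
      ext Y
      have hY := h (Y, g Y + b Y) rfl
      simp only [natPair, LinearMap.add_apply] at hY
      simp only [LinearMap.add_apply, LinearMap.neg_apply]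
      linarith [hgsymm X Y, hskew X Y]
end

section
/- Let g be a symmetric bilinear form and b an alternating bilinear form on V, and let D ⊆ V be a totally isotropic subspace for g (g(X,Y) = 0 for all X, Y ∈ D). Define v(D) = {(X, g♭(X) + b♭(X)) : X ∈ D} ⊆ E and let Ann(D) = {(0, ξ) : ξ ∈ V*, ξ|_D = 0} ⊆ E. Then v(D) ∩ Ann(D) = {0}, the subspace V_i := v(D) ⊕ Ann(D) is totally isotropic for the natural pairing on E, dim V_i = dim D + (dim V − dim D) = dim V, and V_i is a maximal totally isotropic subspace of E (indeed every totally isotropic subspace of E has dimension at most dim V). (Proposition 6.4.1: construction of a maximal isotropic subbundle of E from an isotropic subbundle D_max of TM for a pseudo-Riemannian metric g.) -/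
/-- A subspace which is totally isotropic for the natural pairing on `V × V*` has dimension at
most `dim V`. -/
theorem finrank_le_of_natPair_eq_zero {V : Type*} [AddCommGroup V] [Module ℝ V]
    [FiniteDimensional ℝ V] (W : Submodule ℝ (V × Module.Dual ℝ V))
    (hW : ∀ u ∈ W, ∀ v ∈ W, natPair u v = 0) :
    Module.finrank ℝ W ≤ Module.finrank ℝ V := by
  let φ : (V × Module.Dual ℝ V) →ₗ[ℝ] Module.Dual ℝ (V × Module.Dual ℝ V) :=
    LinearMap.mk₂ ℝ natPair
      (fun _ _ _ => by simp [natPair]; ring) (fun _ _ _ => by simp [natPair]; ring)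
      (fun _ _ _ => by simp [natPair]; ring) (fun _ _ _ => by simp [natPair]; ring)
  have hφ_apply (u v : V × Module.Dual ℝ V) : φ u v = natPair u v := rfl
  have hφ : Function.Injective φ := by
    refine (injective_iff_map_eq_zero φ).2 fun u hu => ?_
    have h v : natPair u v = 0 := by rw [← hφ_apply, hu, LinearMap.zero_apply]
    refine Prod.ext ((Module.forall_dual_apply_eq_zero_iff ℝ u.1).1 fun η => ?_)
      (LinearMap.ext fun X => ?_)
    · simpa [natPair] using h (0, η)
    · simpa [natPair] using h (X, 0)
  have hle : W.map φ ≤ W.dualAnnihilator := by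
    rintro _ ⟨u, hu, rfl⟩
    exact (Submodule.mem_dualAnnihilator _).2 fun v hv => hW u hu v hv
  have h₁ := Submodule.finrank_mono hle
  rw [← (Submodule.equivMapOfInjective φ hφ W).finrank_eq] at h₁
  have h₂ := Subspace.finrank_add_finrank_dualAnnihilator_eq W
  rw [Module.finrank_prod, Subspace.dual_finrank_eq] at h₂
  omega

/-- Proposition 6.4.1: if `D ⊆ V` is totally isotropic for a symmetric bilinear
form `g`, and `b` is alternating, then `v(D) = {(X, (g+b)X) : X ∈ D}` and
`Ann(D) = {0} × D°` intersect trivially, `V_i = v(D) ⊕ Ann(D)` is totally isotropic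
for the natural pairing, has dimension `dim V`, and is maximal among totally
isotropic subspaces of `E` (all of which have dimension at most `dim V`). -/
theorem stmt_8 (V : Type*) [AddCommGroup V] [Module ℝ V] [FiniteDimensional ℝ V]
    (g b : V →ₗ[ℝ] V →ₗ[ℝ] ℝ)
    (hgsymm : ∀ X Y : V, g X Y = g Y X)
    (halt : ∀ X : V, b X X = 0)
    (D : Submodule ℝ V)
    (hiso : ∀ X ∈ D, ∀ Y ∈ D, g X Y = 0) :
    (D.map ((LinearMap.id : V →ₗ[ℝ] V).prod (g + b)))
        ⊓ (D.dualAnnihilator.map (LinearMap.inr ℝ V (Module.Dual ℝ V))) = ⊥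
    ∧ (∀ u ∈ (D.map ((LinearMap.id : V →ₗ[ℝ] V).prod (g + b)))
          ⊔ (D.dualAnnihilator.map (LinearMap.inr ℝ V (Module.Dual ℝ V))),
        ∀ v ∈ (D.map ((LinearMap.id : V →ₗ[ℝ] V).prod (g + b)))
          ⊔ (D.dualAnnihilator.map (LinearMap.inr ℝ V (Module.Dual ℝ V))),
        natPair u v = 0)
    ∧ Module.finrank ℝ
        ↥((D.map ((LinearMap.id : V →ₗ[ℝ] V).prod (g + b)))
          ⊔ (D.dualAnnihilator.map (LinearMap.inr ℝ V (Module.Dual ℝ V))))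
        = Module.finrank ℝ D + (Module.finrank ℝ V - Module.finrank ℝ D)
    ∧ Module.finrank ℝ
        ↥((D.map ((LinearMap.id : V →ₗ[ℝ] V).prod (g + b)))
          ⊔ (D.dualAnnihilator.map (LinearMap.inr ℝ V (Module.Dual ℝ V))))
        = Module.finrank ℝ V
    ∧ (∀ W : Submodule ℝ (V × Module.Dual ℝ V),
        (∀ u ∈ W, ∀ v ∈ W, natPair u v = 0) →
          Module.finrank ℝ W ≤ Module.finrank ℝ V) := by
  set A := D.map ((LinearMap.id : V →ₗ[ℝ] V).prod (g + b))
  set B := D.dualAnnihilator.map (LinearMap.inr ℝ V (Module.Dual ℝ V))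
  have hinf : A ⊓ B = ⊥ := by
    refine (Submodule.eq_bot_iff _).2 ?_
    rintro _ ⟨⟨X, -, rfl⟩, ⟨ξ, -, h⟩⟩
    obtain rfl : 0 = X := congrArg Prod.fst h
    exact map_zero _
  have hiso_sup : ∀ u ∈ A ⊔ B, ∀ v ∈ A ⊔ B, natPair u v = 0 := by
    intro u hu v hv
    obtain ⟨_, ⟨X, hX, rfl⟩, _, ⟨ξ, hξ, rfl⟩, rfl⟩ := Submodule.mem_sup.1 hu
    obtain ⟨_, ⟨Y, hY, rfl⟩, _, ⟨η, hη, rfl⟩, rfl⟩ := Submodule.mem_sup.1 hv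
    have hξY : ξ Y = 0 := (Submodule.mem_dualAnnihilator ξ).1 hξ Y hY
    have hηX : η X = 0 := (Submodule.mem_dualAnnihilator η).1 hη X hX
    have hb : -b X Y = b Y X := LinearMap.IsAlt.neg halt X Y
    simp [natPair, hξY, hηX, hiso X hX Y hY, hiso Y hY X hX, ← hb]
  have hdim : Module.finrank ℝ ↥(A ⊔ B) = Module.finrank ℝ V := by
    have hA_dim : Module.finrank ℝ A = Module.finrank ℝ D :=
      (Submodule.equivMapOfInjective _ (fun _ _ h => congrArg Prod.fst h) D).finrank_eq.symm
    have hB_dim : Module.finrank ℝ B = Module.finrank ℝ D.dualAnnihilator :=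
      (Submodule.equivMapOfInjective _ LinearMap.inr_injective _).finrank_eq.symm
    have h := Submodule.finrank_sup_add_finrank_inf_eq A B
    rwa [hinf, finrank_bot, add_zero, hA_dim, hB_dim,
      Subspace.finrank_add_finrank_dualAnnihilator_eq] at h
  exact ⟨hinf, hiso_sup, hdim.trans (Nat.add_sub_of_le D.finrank_le).symm, hdim,
    finrank_le_of_natPair_eq_zero⟩
end
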